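/- For a = (1,1,1,1,1,1,0) ∈ ℝ^7 and independent Rademacher ε_1,...,ε_7, P(|a·ε| ≥ ‖a‖) = 7/32; hence the constant G_7 = inf_{a∈ℝ^7} P(|a·ε| ≥ ‖a‖) equals 7/32. -/

import Mathlib

open Finset
open scoped Classical

/-- sign of a Boolean: `true ↦ 1`, `false ↦ -1` (a Rademacher value). -/
noncomputable def rsign (b : Bool) : ℝ := if b then 1 else -1

/-- Probability of an event under the uniform distribution on `{-1,1}^n`. -/
noncomputable def prob (n : ℕ) (E : (Fin n → Bool) → Prop) : ℝ :=
  ((Finset.univ.filter fun s => E s).card : ℝ) / 2 ^ n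

/-- integer version of `rsign` -/
def isg (b : Bool) : ℤ := if b then 1 else -1

lemma rsign_eq (b : Bool) : rsign b = ((isg b : ℤ) : ℝ) := by
  cases b <;> simp [rsign, isg]

/-- the dominance order on sign vectors: all prefix sums are comparable -/
def dom (s g : Fin 7 → Bool) : Bool :=
  decide (isg (g 0) ≤ isg (s 0)) &&
  decide (isg (g 0) + isg (g 1) ≤ isg (s 0) + isg (s 1)) &&
  decide (isg (g 0) + isg (g 1) + isg (g 2) ≤ isg (s 0) + isg (s 1) + isg (s 2)) &&
  decide (isg (g 0) + isg (g 1) + isg (g 2) + isg (g 3)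
    ≤ isg (s 0) + isg (s 1) + isg (s 2) + isg (s 3)) &&
  decide (isg (g 0) + isg (g 1) + isg (g 2) + isg (g 3) + isg (g 4)
    ≤ isg (s 0) + isg (s 1) + isg (s 2) + isg (s 3) + isg (s 4)) &&
  decide (isg (g 0) + isg (g 1) + isg (g 2) + isg (g 3) + isg (g 4) + isg (g 5)
    ≤ isg (s 0) + isg (s 1) + isg (s 2) + isg (s 3) + isg (s 4) + isg (s 5)) &&
  decide (isg (g 0) + isg (g 1) + isg (g 2) + isg (g 3) + isg (g 4) + isg (g 5) + isg (g 6)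
    ≤ isg (s 0) + isg (s 1) + isg (s 2) + isg (s 3) + isg (s 4) + isg (s 5) + isg (s 6))

lemma dom_le (x : Fin 7 → ℝ) (g1 : 0 ≤ x 0 - x 1) (g2 : 0 ≤ x 1 - x 2) (g3 : 0 ≤ x 2 - x 3)
    (g4 : 0 ≤ x 3 - x 4) (g5 : 0 ≤ x 4 - x 5) (g6 : 0 ≤ x 5 - x 6) (g7 : 0 ≤ x 6)
    (s g : Fin 7 → Bool) (h : dom s g = true) :
    ∑ i, x i * rsign (g i) ≤ ∑ i, x i * rsign (s i) := by
  simp only [dom, Bool.and_eq_true, decide_eq_true_eq] at h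
  obtain ⟨⟨⟨⟨⟨⟨h1, h2⟩, h3⟩, h4⟩, h5⟩, h6⟩, h7⟩ := h
  simp only [Fin.sum_univ_seven, rsign_eq]
  rw [← @Int.cast_le ℝ, ← sub_nonneg] at h1 h2 h3 h4 h5 h6 h7
  push_cast at h1 h2 h3 h4 h5 h6 h7
  linarith [mul_nonneg g1 h1, mul_nonneg g2 h2, mul_nonneg g3 h3, mul_nonneg g4 h4,
    mul_nonneg g5 h5, mul_nonneg g6 h6, mul_nonneg g7 h7]

/-- First quadratic inequality. -/
lemma cert_one (a b c d e f g t : ℝ) (g1 : 0 ≤ a - b) (g2 : 0 ≤ b - c) (g3 : 0 ≤ c - d)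
    (g4 : 0 ≤ d - e) (g5 : 0 ≤ e - f) (g6 : 0 ≤ f - g) (g7 : 0 ≤ g) (ht : 0 < t)
    (hn : t * t = a * a + b * b + c * c + d * d + e * e + f * f + g * g)
    (s1 : 0 < t - (a + b + c - d - e + f + g)) (s2 : 0 < t - (a + b - c + d + e - f - g))
    (s3 : 0 < t - (a - b + c + d + e - f + g)) (s4 : 0 < t - (-a + b + c + d + e + f - g)) :
    False := by
  linarith [mul_nonneg g1 g3, mul_nonneg g1 g4, mul_nonneg g1 g7, mul_nonneg g1 s1.le,
    mul_nonneg g1 s3.le, mul_nonneg g2 g3, mul_nonneg g2 g4, mul_nonneg g2 s1.le,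
    mul_nonneg g2 s2.le, mul_nonneg g2 s3.le, mul_nonneg g2 s4.le, mul_nonneg g2 ht.le,
    mul_nonneg g3 g4, mul_nonneg g3 s1.le, mul_nonneg g3 s2.le, mul_nonneg g4 s1.le,
    mul_nonneg g4 s2.le, mul_nonneg g4 s3.le, mul_nonneg g5 s3.le, mul_nonneg g5 s4.le,
    mul_nonneg g5 ht.le, mul_nonneg g6 s1.le, mul_nonneg g6 s3.le, mul_nonneg g6 s4.le,
    mul_nonneg g7 s1.le, mul_nonneg g7 s3.le, mul_nonneg g7 s4.le, mul_pos s1 s2,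
    mul_pos s1 ht, mul_pos s2 ht, mul_pos s3 ht]

/-- Second quadratic inequality. -/
lemma cert_two (a b c d e f g t : ℝ) (g1 : 0 ≤ a - b) (g2 : 0 ≤ b - c) (g3 : 0 ≤ c - d)
    (g4 : 0 ≤ d - e) (g5 : 0 ≤ e - f) (g6 : 0 ≤ f - g) (g7 : 0 ≤ g) (ht : 0 < t)
    (hn : t * t = a * a + b * b + c * c + d * d + e * e + f * f + g * g)
    (s1 : 0 < t - (a + b + c - d - e + f - g)) (s2 : 0 < t - (a + b - c + d + e - f + g))
    (s3 : 0 < t - (-a + b + c + d + e + f - g)) :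
    False := by
  linarith [mul_nonneg g1 g2, mul_nonneg g1 g3, mul_nonneg g1 g5, mul_nonneg g1 s1.le,
    mul_nonneg g2 g3, mul_nonneg g2 s1.le, mul_nonneg g2 ht.le, mul_nonneg g3 g4,
    mul_nonneg g3 s1.le, mul_nonneg g3 s2.le, mul_nonneg g3 s3.le, mul_nonneg g4 g6,
    mul_nonneg g4 g7, mul_nonneg g4 s1.le, mul_nonneg g4 s2.le, mul_nonneg g4 s3.le,
    mul_nonneg g5 g7, mul_nonneg g5 s1.le, mul_nonneg g5 s2.le, mul_nonneg g5 ht.le,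
    mul_nonneg g6 s2.le, mul_nonneg g6 s3.le, mul_nonneg g7 s1.le, mul_nonneg g7 s2.le,
    mul_nonneg g7 s3.le, mul_pos s1 ht, mul_pos s2 s2, mul_pos s2 ht]

lemma sum_neg_sign (x : Fin 7 → ℝ) (s : Fin 7 → Bool) :
    ∑ i, x i * rsign (!(s i)) = - ∑ i, x i * rsign (s i) := by
  rw [← Finset.sum_neg_distrib]
  refine Finset.sum_congr rfl fun i _ => ?_
  cases s i <;> simp [rsign]

/-- sign vectors (up to negation) dominating `p` or `q` -/
def gen (p q s : Fin 7 → Bool) : Bool :=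
  dom s p || dom s q || dom (fun i => !(s i)) p || dom (fun i => !(s i)) q

lemma count_gen (x : Fin 7 → ℝ) (g1 : 0 ≤ x 0 - x 1) (g2 : 0 ≤ x 1 - x 2) (g3 : 0 ≤ x 2 - x 3)
    (g4 : 0 ≤ x 3 - x 4) (g5 : 0 ≤ x 4 - x 5) (g6 : 0 ≤ x 5 - x 6) (g7 : 0 ≤ x 6) (t : ℝ)
    (p q : Fin 7 → Bool) (hp : t ≤ ∑ i, x i * rsign (p i)) (hq : t ≤ ∑ i, x i * rsign (q i))
    (hc : 28 ≤ (Finset.univ.filter fun s => gen p q s = true).card) :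
    28 ≤ (Finset.univ.filter fun s : Fin 7 → Bool => |∑ i, x i * rsign (s i)| ≥ t).card := by
  refine hc.trans (Finset.card_le_card ?_)
  intro s hs
  simp only [Finset.mem_filter, Finset.mem_univ, true_and, gen, Bool.or_eq_true] at hs ⊢
  have key := dom_le x g1 g2 g3 g4 g5 g6 g7
  rcases hs with ((h | h) | h) | h
  · exact (hp.trans (key _ _ h)).trans (le_abs_self _)
  · exact (hq.trans (key _ _ h)).trans (le_abs_self _)
  · have := hp.trans (key _ _ h)
    rw [sum_neg_sign] at this
    exact this.trans (neg_le_abs _)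
  · have := hq.trans (key _ _ h)
    rw [sum_neg_sign] at this
    exact this.trans (neg_le_abs _)

lemma count_sorted (x : Fin 7 → ℝ) (hx : Antitone x) (h0 : ∀ i, 0 ≤ x i) :
    28 ≤ (Finset.univ.filter fun s : Fin 7 → Bool =>
      |∑ i, x i * rsign (s i)| ≥ Real.sqrt (∑ i, (x i) ^ 2)).card := by
  have g1 : 0 ≤ x 0 - x 1 := sub_nonneg.2 (hx (by decide))
  have g2 : 0 ≤ x 1 - x 2 := sub_nonneg.2 (hx (by decide))
  have g3 : 0 ≤ x 2 - x 3 := sub_nonneg.2 (hx (by decide))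
  have g4 : 0 ≤ x 3 - x 4 := sub_nonneg.2 (hx (by decide))
  have g5 : 0 ≤ x 4 - x 5 := sub_nonneg.2 (hx (by decide))
  have g6 : 0 ≤ x 5 - x 6 := sub_nonneg.2 (hx (by decide))
  have g7 := h0 6
  have hn : Real.sqrt (∑ i, (x i) ^ 2) * Real.sqrt (∑ i, (x i) ^ 2) = ∑ i, (x i) ^ 2 :=
    Real.mul_self_sqrt (Finset.sum_nonneg fun i _ => sq_nonneg _)
  have ht0 := Real.sqrt_nonneg (∑ i, (x i) ^ 2)
  generalize Real.sqrt (∑ i, (x i) ^ 2) = t at hn ht0 ⊢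
  rcases ht0.eq_or_lt with ht | ht
  · subst ht
    rw [Finset.filter_true_of_mem fun s _ => abs_nonneg _]
    simp
  have hnx : t * t = x 0 * x 0 + x 1 * x 1 + x 2 * x 2 + x 3 * x 3 + x 4 * x 4 + x 5 * x 5
      + x 6 * x 6 := by
    rw [hn, Fin.sum_univ_seven]; ring
  have cnt := count_gen x g1 g2 g3 g4 g5 g6 g7 t
  have c1 := cert_one (x 0) (x 1) (x 2) (x 3) (x 4) (x 5) (x 6) t g1 g2 g3 g4 g5 g6 g7 ht hnx
  have c2 := cert_two (x 0) (x 1) (x 2) (x 3) (x 4) (x 5) (x 6) t g1 g2 g3 g4 g5 g6 g7 ht hnx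
  have e1 : ∑ i, x i * rsign (![true, true, true, false, false, true, true] i)
      = x 0 + x 1 + x 2 - x 3 - x 4 + x 5 + x 6 := by
    simp [Fin.sum_univ_seven, rsign]; ring
  have e2 : ∑ i, x i * rsign (![true, true, false, true, true, false, false] i)
      = x 0 + x 1 - x 2 + x 3 + x 4 - x 5 - x 6 := by
    simp [Fin.sum_univ_seven, rsign]; ring
  have e3 : ∑ i, x i * rsign (![true, false, true, true, true, false, true] i)
      = x 0 - x 1 + x 2 + x 3 + x 4 - x 5 + x 6 := by
    simp [Fin.sum_univ_seven, rsign]; ring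
  have e4 : ∑ i, x i * rsign (![false, true, true, true, true, true, false] i)
      = -x 0 + x 1 + x 2 + x 3 + x 4 + x 5 - x 6 := by
    simp [Fin.sum_univ_seven, rsign]; ring
  have e5 : ∑ i, x i * rsign (![true, true, true, false, false, true, false] i)
      = x 0 + x 1 + x 2 - x 3 - x 4 + x 5 - x 6 := by
    simp [Fin.sum_univ_seven, rsign]; ring
  have e6 : ∑ i, x i * rsign (![true, true, false, true, true, false, true] i)
      = x 0 + x 1 - x 2 + x 3 + x 4 - x 5 + x 6 := by
    simp [Fin.sum_univ_seven, rsign]; ring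
  rw [← e1, ← e2, ← e3, ← e4] at c1
  rw [← e5, ← e6, ← e4] at c2
  simp only [sub_pos] at c1 c2
  by_cases k2 : t ≤ ∑ i, x i * rsign (![true, true, false, true, true, false, false] i)
  · exact cnt _ _ k2 k2 (by decide +kernel)
  by_cases k3 : t ≤ ∑ i, x i * rsign (![true, false, true, true, true, false, true] i)
  · exact cnt _ _ k3 k3 (by decide +kernel)
  by_cases k4 : t ≤ ∑ i, x i * rsign (![false, true, true, true, true, true, false] i)
  · exact cnt _ _ k4 k4 (by decide +kernel)
  by_cases k5 : t ≤ ∑ i, x i * rsign (![true, true, true, false, false, true, false] i)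
  · exact cnt _ _ k5 k5 (by decide +kernel)
  by_cases k1 : t ≤ ∑ i, x i * rsign (![true, true, true, false, false, true, true] i)
  · by_cases k6 : t ≤ ∑ i, x i * rsign (![true, true, false, true, true, false, true] i)
    · exact cnt _ _ k1 k6 (by decide +kernel)
    · exact (c2 (not_le.1 k5) (not_le.1 k6) (not_le.1 k4)).elim
  · exact (c1 (not_le.1 k1) (not_le.1 k2) (not_le.1 k3) (not_le.1 k4)).elim

lemma count_all (a : Fin 7 → ℝ) :
    28 ≤ (Finset.univ.filter fun s : Fin 7 → Bool =>
      |∑ i, a i * rsign (s i)| ≥ Real.sqrt (∑ i, (a i) ^ 2)).card := by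
  obtain ⟨σ, hσ⟩ : ∃ σ : Equiv.Perm (Fin 7), Antitone fun i => |a (σ i)| := by
    refine ⟨Tuple.sort fun i => -|a i|, fun i j hij => ?_⟩
    have := Tuple.monotone_sort (fun i => -|a i|) hij
    simpa using this
  refine (count_sorted (fun i => |a (σ i)|) hσ fun i => abs_nonneg _).trans ?_
  refine Finset.card_le_card_of_injOn
    (fun s j => if a j < 0 then !(s (σ.symm j)) else s (σ.symm j)) ?_ ?_
  · intro s hs
    simp only [Finset.coe_filter, Finset.mem_univ, true_and, Set.mem_ofPred_eq] at hs ⊢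
    have h1 : ∑ i, |a (σ i)| ^ 2 = ∑ i, (a i) ^ 2 := by
      simp only [sq_abs]
      exact Equiv.sum_comp σ fun i => (a i) ^ 2
    have h2 : ∑ i, |a (σ i)| * rsign (s i)
        = ∑ j, a j * rsign (if a j < 0 then !(s (σ.symm j)) else s (σ.symm j)) := by
      rw [← Equiv.sum_comp σ fun j =>
        a j * rsign (if a j < 0 then !(s (σ.symm j)) else s (σ.symm j))]
      refine Finset.sum_congr rfl fun i _ => ?_
      simp only [Equiv.symm_apply_apply]
      split_ifs with h
      · rw [abs_of_neg h]
        cases s i <;> simp [rsign]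
      · rw [abs_of_nonneg (not_lt.1 h)]
    rw [h1, h2] at hs
    exact hs
  · intro s _ s' _ h
    funext i
    have := congrFun h (σ i)
    simp only [Equiv.symm_apply_apply] at this
    split_ifs at this
    · simpa using this
    · exact this

lemma prob_extremal :
    prob 7 (fun s => |∑ i, (![1, 1, 1, 1, 1, 1, 0] : Fin 7 → ℝ) i * rsign (s i)|
        ≥ Real.sqrt (∑ i, ((![1, 1, 1, 1, 1, 1, 0] : Fin 7 → ℝ) i) ^ 2)) = 7 / 32 := by
  have h : ∀ s : Fin 7 → Bool,
      (|∑ i, (![1, 1, 1, 1, 1, 1, 0] : Fin 7 → ℝ) i * rsign (s i)|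
        ≥ Real.sqrt (∑ i, ((![1, 1, 1, 1, 1, 1, 0] : Fin 7 → ℝ) i) ^ 2)) ↔
      decide (6 ≤ (isg (s 0) + isg (s 1) + isg (s 2) + isg (s 3) + isg (s 4) + isg (s 5)) ^ 2)
        = true := by
    intro s
    have e1 : ∑ i, (![1, 1, 1, 1, 1, 1, 0] : Fin 7 → ℝ) i * rsign (s i)
        = ((isg (s 0) + isg (s 1) + isg (s 2) + isg (s 3) + isg (s 4) + isg (s 5) : ℤ) : ℝ) := by
      simp [Fin.sum_univ_seven, rsign_eq]
    have e2 : ∑ i, ((![1, 1, 1, 1, 1, 1, 0] : Fin 7 → ℝ) i) ^ 2 = 6 := by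
      simp [Fin.sum_univ_seven]; norm_num
    rw [e1, e2, decide_eq_true_eq, ge_iff_le, Real.sqrt_le_left (abs_nonneg _), sq_abs]
    exact_mod_cast Iff.rfl
  have hc : (Finset.univ.filter fun s : Fin 7 → Bool =>
      decide (6 ≤ (isg (s 0) + isg (s 1) + isg (s 2) + isg (s 3) + isg (s 4) + isg (s 5)) ^ 2)
        = true).card = 28 := by
    decide +kernel
  unfold prob
  simp only [h]
  have hcR : ((Finset.univ.filter fun s : Fin 7 → Bool =>
      decide (6 ≤ (isg (s 0) + isg (s 1) + isg (s 2) + isg (s 3) + isg (s 4) + isg (s 5)) ^ 2)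
        = true).card : ℝ) = 28 := by exact_mod_cast hc
  convert (by norm_num : (28 : ℝ) / 2 ^ 7 = 7 / 32) using 2

/-- For `a = (1,1,1,1,1,1,0)`, `P(|a·ε| ≥ ‖a‖) = 7/32`; hence
`G_7 = inf_{a ∈ ℝ^7} P(|a·ε| ≥ ‖a‖) = 7/32`. -/
theorem stmt_11 :
    prob 7 (fun s => |∑ i, (![1, 1, 1, 1, 1, 1, 0] : Fin 7 → ℝ) i * rsign (s i)|
        ≥ Real.sqrt (∑ i, ((![1, 1, 1, 1, 1, 1, 0] : Fin 7 → ℝ) i) ^ 2)) = 7 / 32 ∧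
    sInf {p : ℝ | ∃ a : Fin 7 → ℝ,
        p = prob 7 (fun s => |∑ i, a i * rsign (s i)| ≥ Real.sqrt (∑ i, (a i) ^ 2))}
      = 7 / 32 := by
  refine ⟨prob_extremal, IsLeast.csInf_eq ⟨⟨_, prob_extremal.symm⟩, ?_⟩⟩
  rintro p ⟨a, rfl⟩
  have h : (28 : ℝ) ≤ ((Finset.univ.filter fun s : Fin 7 → Bool =>
      |∑ i, a i * rsign (s i)| ≥ Real.sqrt (∑ i, (a i) ^ 2)).card : ℝ) := by
    exact_mod_cast count_all a
  unfold prob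
  rw [le_div_iff₀ (by positivity)]
  refine le_trans (by norm_num) (h.trans (le_of_eq ?_))
  congr!
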